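/- Under the hypotheses of Lemma 6.1 (n ≥ 5; u smooth strictly convex on a convex domain Ω ⊆ ℝⁿ satisfying equation (1.4); u ≥ 0 with u(p) = 0; 0 < C ≤ 1 with S̄_u(p,C) compact in Ω; constants b₁ ≥ 0, d > 1 with |∇u|²/(d+f)² ≤ b₁ and |u+f| ≤ d+f on S̄_u(p,C); α = (n+2)(n−3)/2 + (n−1)/4, m = 32(n+2)C, h = m/(C−u)², ε = 1/(30(1+b₁)), H = ε |∇u|²/(d+f)²), the following comparison of suprema holds: sup over S_u(p,C) of exp(−m/(C−u)) ρ^α Φ/(d+f)^{2nα/(n+2)} ≤ 10 · sup over S_u(p,C) of exp(−m/(C−u) + H)(h+2α) ρ^α/(d+f)^{2nα/(n+2)}. -/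

import Mathlib

noncomputable section

/-- The `i`-th partial derivative of a function on `ℝⁿ`. -/
def pd {n : ℕ} (i : Fin n) (f : (Fin n → ℝ) → ℝ) : (Fin n → ℝ) → ℝ :=
  fun x => fderiv ℝ f x (Pi.single i 1)

/-- The Hessian matrix `(∂²f/∂x_i∂x_j)`. -/
def hess {n : ℕ} (f : (Fin n → ℝ) → ℝ) (x : Fin n → ℝ) : Matrix (Fin n) (Fin n) ℝ :=
  Matrix.of fun i j => pd i (pd j f) x

/-- `ρ = (det D²u)^{1/(n+2)}`. -/
def rhoU {n : ℕ} (u : (Fin n → ℝ) → ℝ) (x : Fin n → ℝ) : ℝ :=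
  (hess u x).det ^ ((1 : ℝ) / (n + 2))

/-- `Φ = ‖∇ρ‖²/ρ²` with respect to the Calabi metric `G = D²u`. -/
def PhiU {n : ℕ} (u : (Fin n → ℝ) → ℝ) (x : Fin n → ℝ) : ℝ :=
  (1 / (rhoU u x) ^ 2) *
    ∑ i : Fin n, ∑ j : Fin n, (hess u x)⁻¹ i j * pd i (rhoU u) x * pd j (rhoU u) x

/-- The Legendre transform function `f(ξ) = ⟨ξ, ∇u(ξ)⟩ − u(ξ)`. -/
def legendreF {n : ℕ} (u : (Fin n → ℝ) → ℝ) (ξ : Fin n → ℝ) : ℝ :=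
  (∑ i : Fin n, ξ i * pd i u ξ) - u ξ

/-- `α = (n+2)(n−3)/2 + (n−1)/4`. -/
def alph (n : ℕ) : ℝ :=
  ((n : ℝ) + 2) * ((n : ℝ) - 3) / 2 + ((n : ℝ) - 1) / 4


open scoped Matrix Topology

abbrev Sm {n : ℕ} (Ω : Set (Fin n → ℝ)) (g : (Fin n → ℝ) → ℝ) : Prop :=
  ContDiffOn ℝ (⊤ : ℕ∞) g Ω

section calcs
variable {n : ℕ} {Ω : Set (Fin n → ℝ)}

lemma Sm.da (hΩ : IsOpen Ω) {g : (Fin n → ℝ) → ℝ} (hg : Sm Ω g) {x : Fin n → ℝ} (hx : x ∈ Ω) :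
    DifferentiableAt ℝ g x :=
  (hg.contDiffAt (hΩ.mem_nhds hx)).differentiableAt (by simp)

lemma Sm.pd (hΩ : IsOpen Ω) {g : (Fin n → ℝ) → ℝ} (hg : Sm Ω g) (i : Fin n) :
    Sm Ω (pd i g) := by
  have h : ContDiffOn ℝ (⊤ : ℕ∞) (fderiv ℝ g) Ω := hg.fderiv_of_isOpen hΩ (by simp)
  exact h.clm_apply contDiffOn_const

lemma pd_congr (hΩ : IsOpen Ω) {f g : (Fin n → ℝ) → ℝ} (h : ∀ x ∈ Ω, f x = g x) (i : Fin n) :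
    ∀ x ∈ Ω, pd i f x = pd i g x := by
  intro x hx
  have : f =ᶠ[𝓝 x] g := by
    filter_upwards [hΩ.mem_nhds hx] with y hy using h y hy
  simp only [pd, this.fderiv_eq]

lemma pd_add' {f g : (Fin n → ℝ) → ℝ} {x : Fin n → ℝ} (hf : DifferentiableAt ℝ f x)
    (hg : DifferentiableAt ℝ g x) (i : Fin n) :
    pd i (fun y => f y + g y) x = pd i f x + pd i g x := by
  simp only [pd]; rw [fderiv_fun_add hf hg]; rfl

lemma pd_sub' {f g : (Fin n → ℝ) → ℝ} {x : Fin n → ℝ} (hf : DifferentiableAt ℝ f x)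
    (hg : DifferentiableAt ℝ g x) (i : Fin n) :
    pd i (fun y => f y - g y) x = pd i f x - pd i g x := by
  simp only [pd]; rw [fderiv_fun_sub hf hg]; rfl

lemma pd_mul' {f g : (Fin n → ℝ) → ℝ} {x : Fin n → ℝ} (hf : DifferentiableAt ℝ f x)
    (hg : DifferentiableAt ℝ g x) (i : Fin n) :
    pd i (fun y => f y * g y) x = pd i f x * g x + f x * pd i g x := by
  simp only [pd]; rw [fderiv_fun_mul hf hg]; simp; ring

lemma pd_cmul {g : (Fin n → ℝ) → ℝ} {x : Fin n → ℝ} (c : ℝ)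
    (hg : DifferentiableAt ℝ g x) (i : Fin n) :
    pd i (fun y => c * g y) x = c * pd i g x := by
  simp only [pd]; rw [fderiv_const_mul hg]; simp

lemma pd_const (c : ℝ) (x : Fin n → ℝ) (i : Fin n) :
    pd i (fun _ => c) x = 0 := by
  simp [pd]

lemma pd_coord (x : Fin n → ℝ) (i k : Fin n) :
    pd i (fun y => y k) x = if i = k then 1 else 0 := by
  simp only [pd]
  have : HasFDerivAt (fun y : Fin n → ℝ => y k) (ContinuousLinearMap.proj (R := ℝ) k) x :=
    (ContinuousLinearMap.proj (R := ℝ) k : (Fin n → ℝ) →L[ℝ] ℝ).hasFDerivAt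
  rw [this.fderiv]
  simp [Pi.single_apply, eq_comm]

lemma pd_sum {ι : Type*} {s : Finset ι} {f : ι → (Fin n → ℝ) → ℝ} {x : Fin n → ℝ}
    (hf : ∀ a ∈ s, DifferentiableAt ℝ (f a) x) (i : Fin n) :
    pd i (fun y => ∑ a ∈ s, f a y) x = ∑ a ∈ s, pd i (f a) x := by
  simp only [pd]; rw [fderiv_fun_sum hf]; simp

lemma pd_comp {g : (Fin n → ℝ) → ℝ} {F : ℝ → ℝ} {F' : ℝ} {x : Fin n → ℝ}
    (hF : HasDerivAt F F' (g x)) (hg : DifferentiableAt ℝ g x) (i : Fin n) :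
    pd i (fun y => F (g y)) x = F' * pd i g x := by
  have := hF.comp_hasFDerivAt x hg.hasFDerivAt
  simp only [pd]
  rw [show (fun y => F (g y)) = F ∘ g from rfl, this.fderiv]; simp

lemma pd_comm (hΩ : IsOpen Ω) {g : (Fin n → ℝ) → ℝ} (hg : Sm Ω g) (i j : Fin n)
    {x : Fin n → ℝ} (hx : x ∈ Ω) : pd i (pd j g) x = pd j (pd i g) x := by
  have hs := (hg.contDiffAt (hΩ.mem_nhds hx)).isSymmSndFDerivAt
    (by rw [minSmoothness_of_isRCLikeNormedField]; exact WithTop.coe_le_coe.2 (le_top : (2 : ℕ∞) ≤ ⊤))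
  have h : ContDiffOn ℝ (⊤ : ℕ∞) (fderiv ℝ g) Ω := hg.fderiv_of_isOpen hΩ (by simp)
  have hd : DifferentiableAt ℝ (fderiv ℝ g) x :=
    (h.contDiffAt (hΩ.mem_nhds hx)).differentiableAt (by simp)
  have key : ∀ a b : Fin n, pd a (pd b g) x
      = fderiv ℝ (fderiv ℝ g) x (Pi.single a 1) (Pi.single b 1) := by
    intro a b
    show fderiv ℝ (fun y => fderiv ℝ g y (Pi.single b 1)) x (Pi.single a 1) = _
    rw [fderiv_clm_apply hd (by fun_prop)]
    simp
  rw [key, key]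
  exact hs _ _

lemma pd_pd_comp (hΩ : IsOpen Ω) {g : (Fin n → ℝ) → ℝ} (hg : Sm Ω g) {F F1 F2 : ℝ → ℝ}
    (h1 : ∀ y ∈ Ω, HasDerivAt F (F1 (g y)) (g y))
    (h2 : ∀ y ∈ Ω, HasDerivAt F1 (F2 (g y)) (g y)) (i j : Fin n) {x : Fin n → ℝ} (hx : x ∈ Ω) :
    pd i (pd j (fun y => F (g y))) x
      = F2 (g x) * (pd i g x * pd j g x) + F1 (g x) * pd i (pd j g) x := by
  rw [pd_congr hΩ (g := fun y => F1 (g y) * pd j g y)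
    (fun y hy => pd_comp (h1 y hy) (hg.da hΩ hy) j) i x hx]
  rw [pd_mul' (f := fun y => F1 (g y)) ((h2 x hx).differentiableAt.comp x (hg.da hΩ hx)) ((hg.pd hΩ j).da hΩ hx),
    pd_comp (h2 x hx) (hg.da hΩ hx)]
  ring

/-- Jacobi's formula. -/
lemma pd_det {M : Fin n → Fin n → (Fin n → ℝ) → ℝ} {x : Fin n → ℝ}
    (hM : ∀ i j, DifferentiableAt ℝ (M i j) x) (k : Fin n) :
    DifferentiableAt ℝ (fun y => (Matrix.of fun i j => M i j y).det) x ∧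
    pd k (fun y => (Matrix.of fun i j => M i j y).det) x
      = ∑ i, ∑ j, (Matrix.of fun i j => M i j x).adjugate j i * pd k (M i j) x := by
  let D : ContinuousMultilinearMap ℝ (fun _ : Fin n => (Fin n → ℝ)) ℝ :=
    ⟨(Matrix.detRowAlternating (R := ℝ) (n := Fin n)).toMultilinearMap, by
      exact (continuous_id (X := Matrix (Fin n) (Fin n) ℝ)).matrix_det⟩
  have hrow : HasFDerivAt (fun y => fun i j => M i j y)
      (ContinuousLinearMap.pi fun i => ContinuousLinearMap.pi fun j => fderiv ℝ (M i j) x) x := by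
    rw [hasFDerivAt_pi]; intro i; rw [hasFDerivAt_pi]; intro j
    exact (hM i j).hasFDerivAt
  have h := (D.hasFDerivAt (fun i j => M i j x)).comp x hrow
  refine ⟨h.differentiableAt, ?_⟩
  have e : pd k (fun y => (Matrix.of fun i j => M i j y).det) x = _ :=
    congrArg (fun L => L (Pi.single k 1)) h.fderiv
  rw [e]
  simp only [ContinuousLinearMap.comp_apply, ContinuousMultilinearMap.linearDeriv_apply]
  refine Finset.sum_congr rfl fun i _ => ?_
  have := Matrix.cramer_transpose_apply (Matrix.of fun i j => M i j x)
    (fun j => pd k (M i j) x) i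
  have h2 : D (Function.update (fun i j => M i j x) i fun j => pd k (M i j) x)
     = ((Matrix.of fun i j => M i j x).updateRow i fun j => pd k (M i j) x).det := rfl
  refine Eq.trans h2 ?_
  rw [← this, Matrix.cramer_eq_adjugate_mulVec, ← Matrix.adjugate_transpose]
  simp [Matrix.mulVec, dotProduct]

/-- second order necessary condition at a local max -/
lemma second_order (hΩ : IsOpen Ω) {g : (Fin n → ℝ) → ℝ} (hg : Sm Ω g) {x : Fin n → ℝ}
    (hx : x ∈ Ω) (hmax : IsLocalMax g x) :
    (∀ i, pd i g x = 0) ∧ ∀ v : Fin n → ℝ, ∑ i, ∑ j, v i * v j * pd i (pd j g) x ≤ 0 := by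
  have h0 : fderiv ℝ g x = 0 := hmax.fderiv_eq_zero
  refine ⟨fun i => by simp [pd, h0], fun v => ?_⟩
  have hv : v = ∑ i, v i • (Pi.single i (1:ℝ) : Fin n → ℝ) := by
    ext j; simp [Finset.sum_apply, Pi.single_apply]
  have hl : ∀ t : ℝ, HasDerivAt (fun t : ℝ => x + t • v) v t := by
    intro t
    simpa using ((hasDerivAt_id t).smul_const v).const_add x
  have hlc : Continuous (fun t : ℝ => x + t • v) := by fun_prop
  let γ : ℝ → ℝ := fun t => g (x + t • v)
  have hV : ∀ᶠ t in 𝓝 (0:ℝ), x + t • v ∈ Ω :=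
    hlc.continuousAt.eventually (hΩ.mem_nhds (by simpa using hx))
  have hgen : ∀ (k : (Fin n → ℝ) → ℝ) (t : ℝ), DifferentiableAt ℝ k (x + t • v) →
      HasDerivAt (fun t => k (x + t • v)) (∑ i, v i * pd i k (x + t • v)) t := by
    intro k t hk
    have := hk.hasFDerivAt.comp_hasDerivAt t (hl t)
    have hL : ∀ L : (Fin n → ℝ) →L[ℝ] ℝ, L v = ∑ i, v i * L (Pi.single i 1) := by
      intro L
      conv_lhs => rw [hv]
      simp
    rw [hL] at this
    exact this
  have hd1 : ∀ᶠ t in 𝓝 (0:ℝ), deriv γ t = ∑ i, v i * pd i g (x + t • v) := by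
    filter_upwards [hV] with t ht
    exact (hgen g t (hg.da hΩ ht)).deriv
  have hd2 : deriv (deriv γ) 0 = ∑ i, ∑ j, v i * v j * pd i (pd j g) x := by
    rw [Filter.EventuallyEq.deriv_eq hd1]
    have hx' : x + (0:ℝ) • v ∈ Ω := by simpa using hx
    have : HasDerivAt (fun t : ℝ => ∑ j, v j * pd j g (x + t • v))
        (∑ j, v j * ∑ i, v i * pd i (pd j g) (x + (0:ℝ) • v)) 0 := by
      apply HasDerivAt.fun_sum
      intro j _
      exact (hgen (pd j g) 0 ((hg.pd hΩ j).da hΩ hx')).const_mul (v j)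
    rw [this.deriv, Finset.sum_comm]
    simp only [zero_smul, add_zero, Finset.mul_sum]
    exact Finset.sum_congr rfl fun i _ => Finset.sum_congr rfl fun j _ => by ring
  rw [← hd2]
  by_contra hpos
  push Not at hpos
  have hγmax : IsLocalMax γ 0 := by
    have : ContinuousAt (fun t : ℝ => x + t • v) 0 := hlc.continuousAt
    have hm : ∀ᶠ y in 𝓝 (x + (0:ℝ) • v), g y ≤ g x := by rw [zero_smul, add_zero]; exact hmax
    have := this.eventually hm
    filter_upwards [this] with t ht
    simpa [γ] using ht
  have hγ0 : deriv γ 0 = 0 := hγmax.deriv_eq_zero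
  have hcont : ContinuousAt γ 0 :=
    (hgen g 0 (hg.da hΩ (by simpa using hx))).continuousAt
  have hγmin := isLocalMin_of_deriv_deriv_pos hpos hγ0 hcont
  have heq : γ =ᶠ[𝓝 0] fun _ => γ 0 := by
    filter_upwards [hγmax, hγmin] with t h1 h2 using le_antisymm h1 h2
  have h3 : deriv (deriv γ) 0 = 0 := by
    rw [heq.deriv.deriv_eq]; simp
  linarith

end calcs
section algebra

lemma sum_sum_mul {n : ℕ} (f g : Fin n → ℝ) :
    ∑ i, ∑ j, f i * g j = (∑ i, f i) * ∑ j, g j := by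
  rw [Finset.sum_mul_sum]

lemma frob_ineq {n : ℕ} (hn : 5 ≤ n) (b : Fin n → Fin n → ℝ) (hb : ∀ i j, b i j = b j i)
    (δ β : Fin n → ℝ) (q : ℝ) (hq : q = ∑ i, δ i ^ 2) (hqpos : 0 < q)
    (htr : ∑ i, b i i = -q) (hβ : ∀ i, β i = ∑ j, b i j * δ j) :
    (1 / ((n : ℝ) - 1)) * ∑ i, (β i / q + δ i) ^ 2
      ≤ (∑ i, ∑ j, b i j ^ 2) / q - (∑ i, β i ^ 2) / q ^ 2 := by
  have hn' : (5 : ℝ) ≤ n := by exact_mod_cast hn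
  have hn1 : 0 < (n : ℝ) - 1 := by linarith
  set B := ∑ i, ∑ j, b i j ^ 2 with hB
  set R := ∑ i, β i ^ 2 with hR
  set z := ∑ i, β i * δ i with hz
  let e : Fin n → Fin n → ℝ := fun i j => if i = j then 1 else 0
  have he2 : ∀ i j, e i j ^ 2 = e i j := by intro i j; simp only [e]; split_ifs <;> norm_num
  have hexp : ∀ r k t : ℝ, 0 ≤ B + r ^ 2 * (2 * R * q + 2 * z ^ 2) + k ^ 2 * q ^ 2 + t ^ 2 * n
      - 4 * r * R + 2 * k * z + 2 * t * q - 4 * r * k * z * q + 4 * r * t * z - 2 * k * t * q := by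
    intro r k t
    have h0 : 0 ≤ ∑ i, ∑ j,
        (b i j - r * (β i * δ j + δ i * β j) + k * (δ i * δ j) - t * e i j) ^ 2 :=
      Finset.sum_nonneg fun i _ => Finset.sum_nonneg fun j _ => sq_nonneg _
    have s3 : ∑ i, ∑ j, b i j * (β i * δ j) = R := by
      rw [hR]; refine Finset.sum_congr rfl fun i _ => ?_
      rw [pow_two]; nth_rewrite 3 [hβ i]; rw [Finset.mul_sum]
      exact Finset.sum_congr rfl fun j _ => by ring
    have s3' : ∑ i, ∑ j, b i j * (δ i * β j) = R := by
      rw [Finset.sum_comm, ← s3]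
      exact Finset.sum_congr rfl fun i _ => Finset.sum_congr rfl fun j _ => by rw [hb]; ring
    have s4 : ∑ i, ∑ j, b i j * (δ i * δ j) = z := by
      rw [hz]; refine Finset.sum_congr rfl fun i _ => ?_
      rw [hβ i, Finset.sum_mul]
      exact Finset.sum_congr rfl fun j _ => by ring
    have s5 : ∑ i, ∑ j, b i j * e i j = -q := by
      rw [← htr]; simp [e]
    have s7 : ∑ i, ∑ j, (β i * δ j) * e i j = z := by simp [e, hz]
    have s7' : ∑ i, ∑ j, (δ i * β j) * e i j = z := by simp [e, hz, mul_comm]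
    have s8 : ∑ i, ∑ j, (δ i * δ j) * e i j = q := by simp [e, hq, pow_two]
    have s9 : ∑ i, ∑ j, e i j = n := by simp [e]
    have hsum : ∑ i, ∑ j,
        (b i j - r * (β i * δ j + δ i * β j) + k * (δ i * δ j) - t * e i j) ^ 2
        = ∑ i, ∑ j, (b i j ^ 2 + r ^ 2 * (β i ^ 2 * δ j ^ 2) + r ^ 2 * (δ i ^ 2 * β j ^ 2)
          + 2 * r ^ 2 * ((β i * δ i) * (β j * δ j)) + k ^ 2 * (δ i ^ 2 * δ j ^ 2)
          + t ^ 2 * e i j - 2 * r * (b i j * (β i * δ j)) - 2 * r * (b i j * (δ i * β j))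
          + 2 * k * (b i j * (δ i * δ j)) - 2 * t * (b i j * e i j)
          - 2 * r * k * ((β i * δ i) * (δ j ^ 2)) - 2 * r * k * ((δ i ^ 2) * (β j * δ j))
          + 2 * r * t * ((β i * δ j) * e i j) + 2 * r * t * ((δ i * β j) * e i j)
          - 2 * k * t * ((δ i * δ j) * e i j)) := by
      refine Finset.sum_congr rfl fun i _ => Finset.sum_congr rfl fun j _ => ?_
      linear_combination t ^ 2 * he2 i j
    rw [hsum] at h0
    simp only [Finset.sum_add_distrib, Finset.sum_sub_distrib, ← Finset.mul_sum,
      s3, s3', s4, s5, s7, s7', s8, s9] at h0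
    simp only [← Finset.sum_mul, ← hB, ← hR, ← hz, ← hq] at h0
    linarith
  have hCS : z ^ 2 ≤ R * q := by
    rw [hz, hR, hq]; exact Finset.sum_mul_sq_le_sq_mul_sq _ _ _
  obtain ⟨Z, hZ⟩ : ∃ Z, z = Z * q := ⟨z / q, by field_simp⟩
  obtain ⟨P, hP⟩ : ∃ P, R = P * q := ⟨R / q, by field_simp⟩
  obtain ⟨t, ht⟩ : ∃ t, t * ((n : ℝ) - 1) = -(q + Z) := ⟨-(q + Z) / (n - 1), by field_simp⟩
  have h1 := hexp (1 / q) ((Z + t) / q) t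
  have h2 : B - 2 * P + Z ^ 2 + t ^ 2 * ((n : ℝ) - 1) + 2 * t * (q + Z) ≥ 0 := by
    have e1 : B + (1 / q) ^ 2 * (2 * R * q + 2 * z ^ 2) + ((Z + t) / q) ^ 2 * q ^ 2 + t ^ 2 * n
      - 4 * (1 / q) * R + 2 * ((Z + t) / q) * z + 2 * t * q - 4 * (1 / q) * ((Z + t) / q) * z * q
      + 4 * (1 / q) * t * z - 2 * ((Z + t) / q) * t * q
      = B - 2 * P + Z ^ 2 + t ^ 2 * ((n : ℝ) - 1) + 2 * t * (q + Z) := by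
      rw [hZ, hP]; field_simp; ring
    linarith
  have hS : ∑ i, (β i / q + δ i) ^ 2 = P / q + 2 * Z + q := by
    have : ∀ i, (β i / q + δ i) ^ 2 = (1 / q ^ 2) * β i ^ 2 + (2 / q) * (β i * δ i) + δ i ^ 2 := by
      intro i; field_simp; ring
    simp only [this, Finset.sum_add_distrib, ← Finset.mul_sum]
    rw [← hq, ← hR, ← hz, hZ, hP]; field_simp
  have hCS' : Z ^ 2 ≤ P := by
    have : Z ^ 2 * q ^ 2 ≤ P * q ^ 2 := by rw [hZ, hP] at hCS; nlinarith
    exact le_of_mul_le_mul_right this (by positivity)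
  rw [hS, hP, ← sub_nonneg]
  have hfin : B / q - P * q / q ^ 2 - 1 / ((n : ℝ) - 1) * (P / q + 2 * Z + q)
      = (((n : ℝ) - 1) * (B - P) - (P + 2 * Z * q + q ^ 2)) / (q * ((n : ℝ) - 1)) := by
    field_simp
  rw [hfin]
  apply div_nonneg _ (by positivity)
  have h3 : ((n : ℝ) - 1) * (B - 2 * P + Z ^ 2) ≥ (q + Z) ^ 2 := by
    have : ((n : ℝ) - 1) * (B - 2 * P + Z ^ 2 + t ^ 2 * ((n : ℝ) - 1) + 2 * t * (q + Z)) ≥ 0 :=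
      mul_nonneg hn1.le h2
    have e2 : ((n : ℝ) - 1) * (t ^ 2 * ((n : ℝ) - 1) + 2 * t * (q + Z)) = - (q + Z) ^ 2 := by
      linear_combination (t * ((n : ℝ) - 1) + (q + Z)) * ht
    nlinarith
  nlinarith [mul_nonneg (by linarith : (0:ℝ) ≤ n - 2) (sub_nonneg.2 hCS')]

set_option maxHeartbeats 1000000 in
lemma final_scalar (n : ℝ) (hn : 5 ≤ n) (α β κ h t s xx q ww xd xw dw : ℝ)
    (hα : α = (n + 2) * (n - 3) / 2 + (n - 1) / 4)
    (hβ : β = 1 + α / (n + 2)) (hκ : κ = 2 * n * α / (n + 2))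
    (hh : 0 < h) (ht : 0 < t) (hs : 0 < s) (hth : 32 * (n + 2) ≤ h * t)
    (hst : t ≤ 2 * s) (hxx : 0 ≤ xx) (hq : 0 ≤ q) (hxw : |xw| ≤ h)
    (F1 : ∀ a b : ℝ, 0 ≤ a ^ 2 * q + 2 * a * b * dw + b ^ 2 * ww)
    (F2 : ∀ a b : ℝ, 0 ≤ a ^ 2 * xx + 2 * a * b * xd + b ^ 2 * q)
    (hmain : -h * n - xd - 2 * xx / (h * t) +
      (1 / (n - 1)) * (xx + β ^ 2 * q + κ ^ 2 * ww + 2 * β * xd + 2 * κ * xw + 2 * β * κ * dw)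
      - κ * n / s + κ * ww ≤ 0) :
    q ≤ 10 * (n + 2) ^ 2 * h := by
  have hn1 : 0 < n - 1 := by linarith
  have hn2 : 0 < n + 2 := by linarith
  have hβ' : β = (n - 1) * (2 * n + 5) / (4 * (n + 2)) := by
    rw [hβ, hα]; field_simp; ring
  have hκ' : κ = 2 * n * (β - 1) := by rw [hκ, hβ]; field_simp; ring
  have hβ1 : 2 ≤ β := by
    rw [hβ', le_div_iff₀ (by positivity)]; nlinarith
  have hβ2 : β ≤ n / 2 := by
    rw [hβ', div_le_div_iff₀ (by positivity) (by positivity)]; nlinarith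
  have hκ0 : 0 < κ := by rw [hκ']; nlinarith
  have hκ1 : κ ≤ n * (n - 1) := by rw [hκ']; nlinarith
  have b1 : 2 * xx / (h * t) ≤ xx / (16 * (n + 2)) := by
    rw [div_le_div_iff₀ (by positivity) (by positivity)]; nlinarith
  have b2 : κ * n / s ≤ n ^ 2 * h / 16 := by
    have : 16 * (n + 2) ≤ h * s := by nlinarith
    rw [div_le_div_iff₀ hs (by norm_num)]
    have h1 : κ ≤ n * (n + 2) := by nlinarith
    have h2 : κ * n * 16 ≤ n ^ 2 * (16 * (n + 2)) := by nlinarith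
    nlinarith [mul_le_mul_of_nonneg_left this (sq_nonneg n)]
  have b3 : (1 / (n - 1)) * (2 * κ * xw) ≥ - (2 * n * h) := by
    have h1 : -h ≤ xw := (abs_le.1 hxw).1
    have h2 : 1 / (n - 1) * (2 * κ * xw) = (κ / (n - 1)) * (2 * xw) := by ring
    have h3 : κ / (n - 1) ≤ n := by rw [div_le_iff₀ hn1]; exact hκ1
    have h4 : 0 ≤ κ / (n - 1) := by positivity
    rw [h2]; nlinarith
  have b4 : (1 / (n - 1)) * (β ^ 2 * q + κ ^ 2 * ww + 2 * β * κ * dw) + κ * ww ≥ q / 4 := by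
    have hc : 0 < κ + (n - 1) := by linarith
    have h1 := F1 (β * κ) (κ * (κ + (n - 1)))
    have h2 : 0 ≤ β ^ 2 * κ * q + 2 * β * κ * (κ + (n - 1)) * dw
        + κ * (κ + (n - 1)) ^ 2 * ww := by
      have : κ * (β ^ 2 * κ * q + 2 * β * κ * (κ + (n - 1)) * dw
        + κ * (κ + (n - 1)) ^ 2 * ww) ≥ 0 := by
        refine h1.trans (le_of_eq ?_)
        ring
      exact nonneg_of_mul_nonneg_right this hκ0
    have h3 : (1 / (n - 1)) * (β ^ 2 * q + κ ^ 2 * ww + 2 * β * κ * dw) + κ * ww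
      = (β ^ 2 * q * (n - 1) + (β ^ 2 * κ * q + 2 * β * κ * (κ + (n - 1)) * dw
        + κ * (κ + (n - 1)) ^ 2 * ww)) / ((n - 1) * (κ + (n - 1))) := by
      field_simp; ring
    have h4 : κ + (n - 1) ≤ 4 * β ^ 2 := by
      have : 4 * β ^ 2 - (κ + (n - 1))
        = (n + 1) - (n - 1) * (2 * n + 5) * (n + 5) / (4 * (n + 2) ^ 2) := by
        rw [hκ', hβ']; field_simp; ring
      have h5 : (n - 1) * (2 * n + 5) * (n + 5) / (4 * (n + 2) ^ 2) ≤ n + 1 := by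
        rw [div_le_iff₀ (by positivity), ← sub_nonneg]
        have h0 : 0 < n := by linarith
        have : (n + 1) * (4 * (n + 2) ^ 2) - (n - 1) * (2 * n + 5) * (n + 5)
          = 2 * n ^ 3 + 7 * n ^ 2 + 22 * n + 41 := by ring
        rw [this]; positivity
      linarith
    rw [h3, ge_iff_le, div_le_div_iff₀ (by norm_num) (by positivity)]
    have h6 : q * (n - 1) * (κ + (n - 1)) ≤ q * (n - 1) * (4 * β ^ 2) :=
      mul_le_mul_of_nonneg_left h4 (by positivity)
    nlinarith
  have b5 : (1 / (n - 1)) * (xx + 2 * β * xd) - xd - xx / (16 * (n + 2)) ≥ - (q / 20) := by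
    have h1 : (1 / (n - 1)) * (2 * β * xd) - xd = xd / (2 * (n + 2)) := by
      rw [hβ']; field_simp; ring
    have h2 : xx / (n - 1) ≥ xx / (n + 2) := by
      apply div_le_div_of_nonneg_left hxx hn1 (by linarith)
    have h3 := F2 1 (1 / 2)
    have h4 : xx / (n + 2) - xx / (16 * (n + 2)) + xd / (2 * (n + 2)) + q / (8 * (n + 2)) ≥ 0 := by
      have : xx / (n + 2) - xx / (16 * (n + 2)) + xd / (2 * (n + 2)) + q / (8 * (n + 2))
        = (15 * xx + 8 * xd + 2 * q) / (16 * (n + 2)) := by field_simp; ring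
      rw [this]; apply div_nonneg _ (by positivity); linarith
    have h5 : q / (8 * (n + 2)) ≤ q / 20 :=
      div_le_div_of_nonneg_left hq (by norm_num) (by linarith)
    have h6 : (1 / (n - 1)) * (xx + 2 * β * xd) - xd
      = xx / (n - 1) + ((1 / (n - 1)) * (2 * β * xd) - xd) := by ring
    rw [h6, h1]; linarith
  have hs : q / 5 ≤ h * (3 * n + n ^ 2 / 16) := by nlinarith
  nlinarith [mul_nonneg hh.le (sq_nonneg n), mul_nonneg hh.le hn1.le]

lemma pointwise {n : ℕ} (hn : 5 ≤ n) (U N E a : Matrix (Fin n) (Fin n) ℝ)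
    (hNE : N = E * Eᵀ) (hNU : N * U = 1) (ha : aᵀ = a)
    (g dv ξ : Fin n → ℝ) (q T h t s : ℝ)
    (hq : q = dv ⬝ᵥ (U *ᵥ dv)) (hqpos : 0 < q)
    (htr : (N * a).trace = -q) (hT : T = (N * a * (N * a)).trace)
    (hh : 0 < h) (ht : 0 < t) (hs : 0 < s) (hth : 32 * ((n : ℝ) + 2) ≤ h * t)
    (hst : t ≤ 2 * s) (hgx : |g ⬝ᵥ ξ| ≤ s)
    (hgrad : ∀ i, -h * g i - alph n / (n + 2) * (U *ᵥ dv) i + (a *ᵥ dv) i / q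
      - (2 * (n : ℝ) * alph n / ((n : ℝ) + 2)) * ((U *ᵥ ξ) i / s) = 0)
    (hlap : -h * (n + g ⬝ᵥ dv) - 2 * h / t * (g ⬝ᵥ (N *ᵥ g))
      + (T / q - ((a *ᵥ dv) ⬝ᵥ (N *ᵥ (a *ᵥ dv))) / q ^ 2)
      - (2 * (n : ℝ) * alph n / ((n : ℝ) + 2)) *
        (n / s - ((U *ᵥ ξ) ⬝ᵥ (N *ᵥ (U *ᵥ ξ))) / s ^ 2) ≤ 0) :
    q ≤ 10 * ((n : ℝ) + 2) ^ 2 * h := by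
  have hgam : ∀ v w : Fin n → ℝ, v ⬝ᵥ (N *ᵥ w) = (Eᵀ *ᵥ v) ⬝ᵥ (Eᵀ *ᵥ w) := by
    intro v w
    rw [hNE, ← Matrix.mulVec_mulVec, Matrix.dotProduct_mulVec, ← Matrix.mulVec_transpose]
  have hNUv : ∀ v : Fin n → ℝ, N *ᵥ (U *ᵥ v) = v := by
    intro v; rw [Matrix.mulVec_mulVec, hNU, Matrix.one_mulVec]
  set X := Eᵀ *ᵥ g with hX
  set D := Eᵀ *ᵥ (U *ᵥ dv) with hD
  set W := Eᵀ *ᵥ (U *ᵥ ξ) with hW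
  set b : Matrix (Fin n) (Fin n) ℝ := Eᵀ * a * E with hb
  have hbs : bᵀ = b := by
    rw [hb]; simp [Matrix.transpose_mul, ha, Matrix.mul_assoc]
  have hbD : b *ᵥ D = Eᵀ *ᵥ (a *ᵥ dv) := by
    have : b *ᵥ D = Eᵀ *ᵥ (a *ᵥ ((E * Eᵀ) *ᵥ (U *ᵥ dv))) := by
      rw [hb, hD]; simp only [Matrix.mulVec_mulVec, Matrix.mul_assoc]
    rw [this, ← hNE, hNUv]
  have hDD : D ⬝ᵥ D = q := by
    rw [hD, ← hgam, hNUv, hq, dotProduct_comm]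
  have hbtr : b.trace = -q := by
    rw [← htr, hb, hNE, Matrix.mul_assoc, Matrix.trace_mul_comm, Matrix.mul_assoc,
      Matrix.trace_mul_comm]
  have hbT : T = (b * b).trace := by
    have : b * b = Eᵀ * (a * (N * a * E)) := by
      rw [hb, hNE]; simp only [Matrix.mul_assoc]
    rw [this, Matrix.trace_mul_comm, hT]
    have : a * (N * a * E) * Eᵀ = a * (N * a * N) := by
      rw [hNE]; simp only [Matrix.mul_assoc]
    rw [this, ← Matrix.mul_assoc a, Matrix.trace_mul_comm _ N]
    simp only [Matrix.mul_assoc]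
  have hbT' : T = ∑ i, ∑ j, b i j ^ 2 := by
    rw [hbT, Matrix.trace]
    refine Finset.sum_congr rfl fun i _ => ?_
    rw [Matrix.diag_apply, Matrix.mul_apply]
    refine Finset.sum_congr rfl fun j _ => ?_
    have := congrFun (congrFun hbs i) j
    rw [Matrix.transpose_apply] at this
    rw [this, pow_two]
  have hfrob := frob_ineq hn (fun i j => b i j)
    (fun i j => by
      have := congrFun (congrFun hbs i) j
      rw [Matrix.transpose_apply] at this; exact this.symm) D (b *ᵥ D) q
    (by rw [← hDD]; simp [dotProduct, pow_two]) hqpos hbtr (fun i => rfl)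
  set κ := 2 * (n : ℝ) * alph n / ((n : ℝ) + 2) with hκ
  have hY : ∀ i, (b *ᵥ D) i / q + D i = h * X i + (1 + alph n / (n + 2)) * D i + κ * (W i / s) := by
    intro i
    have hv : (1 / q) • (a *ᵥ dv) = h • g + (alph n / (n + 2)) • (U *ᵥ dv) + (κ / s) • (U *ᵥ ξ) := by
      ext j
      have := hgrad j
      simp only [Pi.smul_apply, Pi.add_apply, smul_eq_mul]
      linear_combination this
    have := congrFun (congrArg (fun v => Eᵀ *ᵥ v) hv) i
    simp only [Matrix.mulVec_add, Matrix.mulVec_smul, Pi.smul_apply, Pi.add_apply,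
      smul_eq_mul] at this
    rw [← hbD, ← hX, ← hD, ← hW] at this
    linear_combination this
  set β := 1 + alph n / (n + 2) with hβ
  have hexp : ∑ i, ((b *ᵥ D) i / q + D i) ^ 2
      = h ^ 2 * (X ⬝ᵥ X) + β ^ 2 * q + κ ^ 2 * (W ⬝ᵥ W / s ^ 2) + 2 * β * (h * (X ⬝ᵥ D))
        + 2 * κ * (h * (X ⬝ᵥ W) / s) + 2 * β * κ * (D ⬝ᵥ W / s) := by
    simp only [hY]
    rw [← hDD]
    simp only [dotProduct, Finset.mul_sum, Finset.sum_div, ← Finset.sum_add_distrib]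
    refine Finset.sum_congr rfl fun i _ => ?_
    field_simp; ring
  have hXD : X ⬝ᵥ D = g ⬝ᵥ dv := by rw [hX, hD, ← hgam, hNUv]
  have hXW : X ⬝ᵥ W = g ⬝ᵥ ξ := by rw [hX, hW, ← hgam, hNUv]
  have hR : ∑ i, (b *ᵥ D) i ^ 2 = (a *ᵥ dv) ⬝ᵥ (N *ᵥ (a *ᵥ dv)) := by
    rw [hgam, ← hbD]; simp [dotProduct, pow_two]
  rw [hexp, ← hbT', hR] at hfrob
  have hWW : (U *ᵥ ξ) ⬝ᵥ (N *ᵥ (U *ᵥ ξ)) = W ⬝ᵥ W := by rw [hgam]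
  have hXX : g ⬝ᵥ (N *ᵥ g) = X ⬝ᵥ X := by rw [hgam]
  rw [hWW, hXX, ← hXD] at hlap
  have hgram : ∀ (v w : Fin n → ℝ) (c e : ℝ),
      0 ≤ c ^ 2 * (v ⬝ᵥ v) + 2 * c * e * (v ⬝ᵥ w) + e ^ 2 * (w ⬝ᵥ w) := by
    intro v w c e
    have : c ^ 2 * (v ⬝ᵥ v) + 2 * c * e * (v ⬝ᵥ w) + e ^ 2 * (w ⬝ᵥ w)
      = ∑ i, (c * v i + e * w i) ^ 2 := by
      simp only [dotProduct, Finset.mul_sum, ← Finset.sum_add_distrib]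
      exact Finset.sum_congr rfl fun i _ => by ring
    rw [this]; exact Finset.sum_nonneg fun i _ => sq_nonneg _
  have hn' : (5 : ℝ) ≤ n := by exact_mod_cast hn
  refine final_scalar n hn' (alph n) β κ h t s (h ^ 2 * (X ⬝ᵥ X)) q (W ⬝ᵥ W / s ^ 2)
    (h * (X ⬝ᵥ D)) (h * (X ⬝ᵥ W) / s) (D ⬝ᵥ W / s) rfl rfl rfl hh ht hs hth hst
    ?_ hqpos.le ?_ ?_ ?_ ?_
  · have := hgram X X 1 0
    have h1 : 0 ≤ X ⬝ᵥ X := by simpa using this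
    positivity
  · rw [hXW, abs_div, abs_mul, abs_of_pos hh, abs_of_pos hs, div_le_iff₀ hs]
    exact mul_le_mul_of_nonneg_left hgx hh.le
  · intro c e
    have := hgram D W c (e / s)
    rw [hDD] at this
    refine this.trans (le_of_eq ?_)
    field_simp
  · intro c e
    have := hgram X D (c * h) e
    rw [hDD] at this
    refine this.trans (le_of_eq ?_)
    ring
  · have e1 : 2 * (h ^ 2 * (X ⬝ᵥ X)) / (h * t) = 2 * h / t * (X ⬝ᵥ X) := by
      field_simp
    rw [e1]
    have e2 : κ * (n / s - W ⬝ᵥ W / s ^ 2) = κ * n / s - κ * (W ⬝ᵥ W / s ^ 2) := by ring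
    rw [e2] at hlap
    linarith

end algebra

section pde
variable {n : ℕ} {Ω : Set (Fin n → ℝ)}

/-- directional derivative along a constant vector -/
def DD (dv : Fin n → ℝ) (g : (Fin n → ℝ) → ℝ) : (Fin n → ℝ) → ℝ :=
  fun x => ∑ l, dv l * pd l g x

lemma Sm.DD (hΩ : IsOpen Ω) {g : (Fin n → ℝ) → ℝ} (hg : Sm Ω g) (dv : Fin n → ℝ) :
    Sm Ω (DD dv g) :=
  ContDiffOn.sum fun l _ => contDiffOn_const.mul (hg.pd hΩ l)

lemma pd_DD (hΩ : IsOpen Ω) {g : (Fin n → ℝ) → ℝ} (hg : Sm Ω g) (dv : Fin n → ℝ) (i : Fin n) :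
    ∀ x ∈ Ω, pd i (DD dv g) x = DD dv (pd i g) x := by
  intro x hx
  unfold DD
  rw [pd_sum (fun l _ => ((hg.pd hΩ l).da hΩ hx).const_mul _)]
  refine Finset.sum_congr rfl fun l _ => ?_
  rw [pd_cmul _ ((hg.pd hΩ l).da hΩ hx), pd_comm hΩ hg i l hx]

lemma DD_congr (hΩ : IsOpen Ω) {f g : (Fin n → ℝ) → ℝ} (h : ∀ x ∈ Ω, f x = g x)
    (dv : Fin n → ℝ) : ∀ x ∈ Ω, DD dv f x = DD dv g x := by
  intro x hx
  exact Finset.sum_congr rfl fun l _ => by rw [pd_congr hΩ h l x hx]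

lemma pd_pd_DD (hΩ : IsOpen Ω) {g : (Fin n → ℝ) → ℝ} (hg : Sm Ω g) (dv : Fin n → ℝ)
    (i j : Fin n) : ∀ x ∈ Ω, pd i (pd j (DD dv g)) x = DD dv (pd i (pd j g)) x := by
  intro x hx
  rw [pd_congr hΩ (pd_DD hΩ hg dv j) i x hx, pd_DD hΩ (hg.pd hΩ j) dv i x hx]

lemma DD_mul (dv : Fin n → ℝ) {f g : (Fin n → ℝ) → ℝ} {x : Fin n → ℝ}
    (hf : DifferentiableAt ℝ f x) (hg : DifferentiableAt ℝ g x) :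
    DD dv (fun y => f y * g y) x = DD dv f x * g x + f x * DD dv g x := by
  unfold DD
  rw [Finset.sum_mul, Finset.mul_sum, ← Finset.sum_add_distrib]
  exact Finset.sum_congr rfl fun l _ => by rw [pd_mul' hf hg]; ring

lemma DD_sum (dv : Fin n → ℝ) {ι : Type*} {s : Finset ι} {f : ι → (Fin n → ℝ) → ℝ}
    {x : Fin n → ℝ} (hf : ∀ a ∈ s, DifferentiableAt ℝ (f a) x) :
    DD dv (fun y => ∑ a ∈ s, f a y) x = ∑ a ∈ s, DD dv (f a) x := by
  unfold DD
  rw [Finset.sum_comm]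
  refine Finset.sum_congr rfl fun l _ => ?_
  rw [pd_sum hf, Finset.mul_sum]

lemma DD_const (dv : Fin n → ℝ) (c : ℝ) (x : Fin n → ℝ) : DD dv (fun _ => c) x = 0 := by
  simp [DD, pd_const]

lemma hess_symm (hΩ : IsOpen Ω) {g : (Fin n → ℝ) → ℝ} (hg : Sm Ω g) {x : Fin n → ℝ}
    (hx : x ∈ Ω) : (hess g x)ᵀ = hess g x := by
  ext i j
  exact pd_comm hΩ hg j i hx

lemma trace_mul_hess (A : Matrix (Fin n) (Fin n) ℝ) (g : (Fin n → ℝ) → ℝ) (x : Fin n → ℝ) :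
    (A * hess g x).trace = ∑ i, ∑ j, A i j * pd j (pd i g) x := by
  simp [Matrix.trace, Matrix.mul_apply, hess]

lemma inv_diff (hΩ : IsOpen Ω) {u : (Fin n → ℝ) → ℝ} (hu : Sm Ω u)
    (hconv : ∀ x ∈ Ω, (hess u x).PosDef) {x : Fin n → ℝ} (hx : x ∈ Ω) (i j : Fin n) :
    DifferentiableAt ℝ (fun y => (hess u y)⁻¹ i j) x := by
  have hd : ∀ a b, DifferentiableAt ℝ (pd a (pd b u)) x :=
    fun a b => ((hu.pd hΩ b).pd hΩ a).da hΩ hx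
  have h1 : DifferentiableAt ℝ (fun y => (hess u y).det) x := (pd_det hd i).1
  have h2 : DifferentiableAt ℝ (fun y => (hess u y).adjugate i j) x := by
    have := (pd_det (M := fun a b => if a = j then (fun _ => (Pi.single i 1 : Fin n → ℝ) b)
      else pd a (pd b u)) (x := x) (by
        intro a b
        by_cases h : a = j
        · simp only [h, if_true]; exact differentiableAt_const _
        · simp only [h, if_false]; exact hd a b) i).1
    convert this using 2 with y
    rw [Matrix.adjugate_apply]
    congr 1
    ext a b
    by_cases h : a = j
    · simp [h]
    · simp [h, hess]
  have h3 : (fun y => (hess u y)⁻¹ i j) = fun y => (hess u y).det⁻¹ * (hess u y).adjugate i j := by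
    funext y; rw [Matrix.inv_def]; simp
  rw [h3]
  exact (h1.inv (hconv x hx).det_pos.ne').mul h2


lemma inv_mul_hess (_hΩ : IsOpen Ω) {u : (Fin n → ℝ) → ℝ} (_hu : Sm Ω u)
    (hconv : ∀ x ∈ Ω, (hess u x).PosDef)
    {x : Fin n → ℝ} (hx : x ∈ Ω) : (hess u x)⁻¹ * hess u x = 1 :=
  Matrix.nonsing_inv_mul _ (isUnit_iff_ne_zero.2 (hconv x hx).det_pos.ne')

lemma DD_inv (hΩ : IsOpen Ω) {u : (Fin n → ℝ) → ℝ} (hu : Sm Ω u)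
    (hconv : ∀ x ∈ Ω, (hess u x).PosDef) {dv : Fin n → ℝ}
    {x : Fin n → ℝ} (hx : x ∈ Ω) (i j : Fin n) :
    DD dv (fun y => (hess u y)⁻¹ i j) x
      = -((hess u x)⁻¹ * hess (DD dv u) x * (hess u x)⁻¹) i j := by
  have hN := inv_mul_hess hΩ hu hconv hx
  have hN' : hess u x * (hess u x)⁻¹ = 1 := mul_eq_one_comm.1 hN
  let DN : Matrix (Fin n) (Fin n) ℝ := Matrix.of fun i j => DD dv (fun y => (hess u y)⁻¹ i j) x
  have key : DN * hess u x + (hess u x)⁻¹ * hess (DD dv u) x = 0 := by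
    ext a b
    have h1 : ∀ y ∈ Ω, ∑ k, (hess u y)⁻¹ a k * pd k (pd b u) y = (1 : Matrix (Fin n) (Fin n) ℝ) a b := by
      intro y hy
      rw [← inv_mul_hess hΩ hu hconv hy]; rfl
    have h2 := DD_congr hΩ h1 dv x hx
    rw [DD_const, DD_sum dv (fun k _ => (inv_diff hΩ hu hconv hx a k).fun_mul
      (((hu.pd hΩ b).pd hΩ k).da hΩ hx))] at h2
    simp only [DD_mul dv (inv_diff hΩ hu hconv hx a _) (((hu.pd hΩ b).pd hΩ _).da hΩ hx),
      Finset.sum_add_distrib] at h2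
    rw [Matrix.add_apply, Matrix.mul_apply, Matrix.mul_apply, Matrix.zero_apply, ← h2]
    congr 1
    refine Finset.sum_congr rfl fun k _ => ?_
    rw [← pd_pd_DD hΩ hu dv k b x hx]; rfl
  have : DN = -((hess u x)⁻¹ * hess (DD dv u) x * (hess u x)⁻¹) := by
    have h3 : DN * hess u x * (hess u x)⁻¹
      = -((hess u x)⁻¹ * hess (DD dv u) x) * (hess u x)⁻¹ := by
      rw [eq_neg_of_add_eq_zero_left key]
    rw [Matrix.mul_assoc, hN', Matrix.mul_one, Matrix.neg_mul] at h3
    exact h3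
  exact congrFun (congrFun this i) j


lemma lap_pd (hΩ : IsOpen Ω) {u : (Fin n → ℝ) → ℝ} (hu : Sm Ω u)
    (hconv : ∀ x ∈ Ω, (hess u x).PosDef) {dv : Fin n → ℝ} {d0 : ℝ}
    (hpde : ∀ ξ ∈ Ω, (hess u ξ).det = Real.exp (-(DD dv u ξ) - d0))
    {x : Fin n → ℝ} (hx : x ∈ Ω) (k : Fin n) :
    ((hess u x)⁻¹ * hess (pd k u) x).trace = - pd k (DD dv u) x := by
  have hd : ∀ a b, DifferentiableAt ℝ (pd a (pd b u)) x :=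
    fun a b => ((hu.pd hΩ b).pd hΩ a).da hΩ hx
  have h1 := (pd_det hd k).2
  have h2 : pd k (fun y => (hess u y).det) x = (hess u x).det * (- pd k (DD dv u) x) := by
    rw [pd_congr hΩ hpde k x hx, hpde x hx]
    have hD := (hu.DD hΩ dv).da hΩ hx
    have : HasDerivAt (fun t => Real.exp (-t - d0)) (Real.exp (-(DD dv u x) - d0) * (-1))
        (DD dv u x) := by
      have := (((hasDerivAt_id (DD dv u x)).neg).sub_const d0).exp
      simpa using this
    rw [pd_comp this hD]; ring
  have hdet := (hconv x hx).det_pos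
  have h3 : ∀ i j, (hess u x).adjugate i j = (hess u x).det * (hess u x)⁻¹ i j := by
    intro i j
    rw [Matrix.inv_def]; simp [hdet.ne']
  have h4 : (hess u x).det * (- pd k (DD dv u) x)
      = (hess u x).det * ((hess u x)⁻¹ * hess (pd k u) x).trace := by
    rw [← h2]
    refine h1.trans ?_
    rw [trace_mul_hess, Finset.sum_comm, Finset.mul_sum]
    refine Finset.sum_congr rfl fun i _ => ?_
    rw [Finset.mul_sum]
    refine Finset.sum_congr rfl fun j _ => ?_
    have h5 := h3 i j
    unfold hess at h5
    rw [h5, pd_comm hΩ (hu.pd hΩ i) k j hx,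
      pd_congr hΩ (fun y hy => pd_comm hΩ hu k i hy) j x hx]
    unfold hess
    ring
  exact (mul_left_cancel₀ hdet.ne' h4).symm

lemma lap_ud (hΩ : IsOpen Ω) {u : (Fin n → ℝ) → ℝ} (hu : Sm Ω u)
    (hconv : ∀ x ∈ Ω, (hess u x).PosDef) {dv : Fin n → ℝ} {d0 : ℝ}
    (hpde : ∀ ξ ∈ Ω, (hess u ξ).det = Real.exp (-(DD dv u ξ) - d0))
    {x : Fin n → ℝ} (hx : x ∈ Ω) :
    ((hess u x)⁻¹ * hess (DD dv u) x).trace = - DD dv (DD dv u) x := by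
  have : DD dv (DD dv u) x = ∑ k, dv k * pd k (DD dv u) x := rfl
  rw [this, ← Finset.sum_neg_distrib]
  have h2 : ∀ k ∈ Finset.univ, -(dv k * pd k (DD dv u) x)
      = dv k * ((hess u x)⁻¹ * hess (pd k u) x).trace := by
    intro k _
    rw [lap_pd hΩ hu hconv hpde hx k]; ring
  rw [Finset.sum_congr rfl h2]
  simp only [trace_mul_hess, Finset.mul_sum]
  have h3 : ∀ G : Fin n → Fin n → Fin n → ℝ, ∑ k, ∑ i, ∑ j, G k i j = ∑ i, ∑ j, ∑ k, G k i j := by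
    intro G
    rw [Finset.sum_comm]
    exact Finset.sum_congr rfl fun i _ => Finset.sum_comm
  rw [h3]
  refine Finset.sum_congr rfl fun i _ => ?_
  refine Finset.sum_congr rfl fun j _ => ?_
  rw [pd_pd_DD hΩ hu dv j i x hx]
  unfold DD
  rw [Finset.mul_sum]
  refine Finset.sum_congr rfl fun k _ => ?_
  rw [pd_comm hΩ (hu.pd hΩ i) k j hx,
      pd_congr hΩ (fun y hy => pd_comm hΩ hu k i hy) j x hx]
  ring

lemma lap_q (hΩ : IsOpen Ω) {u : (Fin n → ℝ) → ℝ} (hu : Sm Ω u)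
    (hconv : ∀ x ∈ Ω, (hess u x).PosDef) {dv : Fin n → ℝ} {d0 : ℝ}
    (hpde : ∀ ξ ∈ Ω, (hess u ξ).det = Real.exp (-(DD dv u ξ) - d0))
    {x : Fin n → ℝ} (hx : x ∈ Ω) :
    ((hess u x)⁻¹ * hess (DD dv (DD dv u)) x).trace
      = - DD dv (DD dv (DD dv u)) x
        + ((hess u x)⁻¹ * hess (DD dv u) x * ((hess u x)⁻¹ * hess (DD dv u) x)).trace := by
  have hud := hu.DD hΩ dv
  have hF : ∀ y ∈ Ω, ∑ i, ∑ j, (hess u y)⁻¹ i j * pd j (pd i (DD dv u)) y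
      = (-1) * DD dv (DD dv u) y := by
    intro y hy
    rw [← trace_mul_hess, lap_ud hΩ hu hconv hpde hy]; ring
  have h1 := DD_congr hΩ hF dv x hx
  have hdi := fun i j => inv_diff hΩ hu hconv hx i j
  have hdj : ∀ i j, DifferentiableAt ℝ (pd j (pd i (DD dv u))) x := fun i j =>
    ((hud.pd hΩ i).pd hΩ j).da hΩ hx
  rw [DD_mul dv (differentiableAt_const _) ((hud.DD hΩ dv).da hΩ hx), DD_const,
    DD_sum dv (fun i _ => DifferentiableAt.fun_sum fun j _ => (hdi i j).fun_mul (hdj i j))] at h1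
  have h2 : ∀ i ∈ Finset.univ, DD dv (fun y => ∑ j, (hess u y)⁻¹ i j * pd j (pd i (DD dv u)) y) x
      = ∑ j, (DD dv (fun y => (hess u y)⁻¹ i j) x * pd j (pd i (DD dv u)) x
        + (hess u x)⁻¹ i j * pd j (pd i (DD dv (DD dv u))) x) := by
    intro i _
    rw [DD_sum dv (fun j _ => (hdi i j).fun_mul (hdj i j))]
    refine Finset.sum_congr rfl fun j _ => ?_
    rw [DD_mul dv (hdi i j) (hdj i j), pd_pd_DD hΩ hud dv j i x hx]
  rw [Finset.sum_congr rfl h2] at h1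
  simp only [Finset.sum_add_distrib] at h1
  rw [← trace_mul_hess] at h1
  have h3 : ∑ i, ∑ j, DD dv (fun y => (hess u y)⁻¹ i j) x * pd j (pd i (DD dv u)) x
      = - ((hess u x)⁻¹ * hess (DD dv u) x * ((hess u x)⁻¹ * hess (DD dv u) x)).trace := by
    rw [← Matrix.mul_assoc, trace_mul_hess, ← Finset.sum_neg_distrib]
    refine Finset.sum_congr rfl fun i _ => ?_
    rw [← Finset.sum_neg_distrib]
    refine Finset.sum_congr rfl fun j _ => ?_
    rw [DD_inv hΩ hu hconv hx]; ring
  rw [h3] at h1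
  linarith

lemma sm_f (hΩ : IsOpen Ω) {u : (Fin n → ℝ) → ℝ} (hu : Sm Ω u)
    : Sm Ω (legendreF u) := by
  unfold legendreF
  apply ContDiffOn.sub _ hu
  apply ContDiffOn.sum
  intro i _
  exact (contDiff_apply ℝ ℝ i).contDiffOn.mul (hu.pd hΩ i)

lemma pd_f (hΩ : IsOpen Ω) {u : (Fin n → ℝ) → ℝ} (hu : Sm Ω u)
    (i : Fin n) : ∀ x ∈ Ω, pd i (legendreF u) x = ∑ k, x k * pd i (pd k u) x := by
  intro x hx
  have hc : ∀ k : Fin n, DifferentiableAt ℝ (fun y : Fin n → ℝ => y k) x := fun k => by fun_prop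
  have hk := fun k => (hu.pd hΩ k).da hΩ hx
  have : pd i (legendreF u) x = pd i (fun y => (∑ k, y k * pd k u y) - u y) x := rfl
  rw [this, pd_sub' (DifferentiableAt.fun_sum fun k _ => (hc k).fun_mul (hk k)) (hu.da hΩ hx),
    pd_sum (fun k _ => (hc k).fun_mul (hk k))]
  simp only [pd_mul' (hc _) (hk _), pd_coord, Finset.sum_add_distrib]
  simp

lemma lap_f (hΩ : IsOpen Ω) {u : (Fin n → ℝ) → ℝ} (hu : Sm Ω u)
    (hconv : ∀ x ∈ Ω, (hess u x).PosDef) {dv : Fin n → ℝ} {d0 : ℝ}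
    (hpde : ∀ ξ ∈ Ω, (hess u ξ).det = Real.exp (-(DD dv u ξ) - d0))
    {x : Fin n → ℝ} (hx : x ∈ Ω) :
    ((hess u x)⁻¹ * hess (legendreF u) x).trace + DD dv (legendreF u) x = n := by
  have hh : hess (legendreF u) x = hess u x + ∑ k, x k • hess (pd k u) x := by
    ext i j
    have e1 : hess (legendreF u) x i j = pd i (fun y => ∑ k, y k * pd j (pd k u) y) x :=
      pd_congr hΩ (pd_f hΩ hu j) i x hx
    have hc : ∀ k : Fin n, DifferentiableAt ℝ (fun y : Fin n → ℝ => y k) x := fun k => by fun_prop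
    have hk := fun k => ((hu.pd hΩ k).pd hΩ j).da hΩ hx
    rw [e1, pd_sum (fun k _ => (hc k).fun_mul (hk k))]
    simp only [pd_mul' (hc _) (hk _), pd_coord, Finset.sum_add_distrib]
    simp only [Matrix.add_apply, Matrix.sum_apply, Matrix.smul_apply, smul_eq_mul]
    congr 1
    simp only [ite_mul, one_mul, zero_mul, Finset.sum_ite_eq, Finset.mem_univ, if_true]
    exact pd_comm hΩ hu j i hx
  rw [hh, Matrix.mul_add, Matrix.trace_add, inv_mul_hess hΩ hu hconv hx, Matrix.mul_sum,
    Matrix.trace_sum]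
  simp only [Matrix.mul_smul, Matrix.trace_smul, lap_pd hΩ hu hconv hpde hx]
  have : DD dv (legendreF u) x = ∑ k, x k * pd k (DD dv u) x := by
    unfold DD
    simp only [pd_f hΩ hu _ x hx, Finset.mul_sum]
    rw [Finset.sum_comm]
    refine Finset.sum_congr rfl fun k _ => ?_
    have := pd_DD hΩ hu dv k x hx
    unfold DD at this
    rw [this, Finset.mul_sum]
    exact Finset.sum_congr rfl fun l _ => by ring
  rw [this]
  simp

end pde

section maxpt
variable {n : ℕ} {Ω : Set (Fin n → ℝ)}

/-- gradient -/
def gr (g : (Fin n → ℝ) → ℝ) (x : Fin n → ℝ) : Fin n → ℝ := fun i => pd i g x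

/-- the drifted Laplacian at a point -/
def LL (A : Matrix (Fin n) (Fin n) ℝ) (dv : Fin n → ℝ) (g : (Fin n → ℝ) → ℝ) (x : Fin n → ℝ) : ℝ :=
  (A * hess g x).trace + DD dv g x

lemma LL_eq (A : Matrix (Fin n) (Fin n) ℝ) (dv : Fin n → ℝ) (g : (Fin n → ℝ) → ℝ)
    (x : Fin n → ℝ) : LL A dv g x
      = (∑ i, ∑ j, A i j * pd j (pd i g) x) + ∑ l, dv l * pd l g x := by
  unfold LL; rw [trace_mul_hess]; rfl

lemma LL_add (hΩ : IsOpen Ω) {f g : (Fin n → ℝ) → ℝ} (hf : Sm Ω f) (hg : Sm Ω g)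
    (A : Matrix (Fin n) (Fin n) ℝ) (dv : Fin n → ℝ) {x : Fin n → ℝ} (hx : x ∈ Ω) :
    LL A dv (fun y => f y + g y) x = LL A dv f x + LL A dv g x := by
  have h1 : ∀ i, ∀ y ∈ Ω, pd i (fun y => f y + g y) y = pd i f y + pd i g y :=
    fun i y hy => pd_add' (hf.da hΩ hy) (hg.da hΩ hy) i
  have h2 : ∀ i j, pd j (pd i (fun y => f y + g y)) x = pd j (pd i f) x + pd j (pd i g) x := by
    intro i j
    rw [pd_congr hΩ (h1 i) j x hx, pd_add' ((hf.pd hΩ i).da hΩ hx) ((hg.pd hΩ i).da hΩ hx)]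
  simp only [LL_eq, h2, h1 _ x hx, mul_add, Finset.sum_add_distrib]
  ring

lemma LL_cmul (hΩ : IsOpen Ω) {g : (Fin n → ℝ) → ℝ} (hg : Sm Ω g) (c : ℝ)
    (A : Matrix (Fin n) (Fin n) ℝ) (dv : Fin n → ℝ) {x : Fin n → ℝ} (hx : x ∈ Ω) :
    LL A dv (fun y => c * g y) x = c * LL A dv g x := by
  have h1 : ∀ i, ∀ y ∈ Ω, pd i (fun y => c * g y) y = c * pd i g y :=
    fun i y hy => pd_cmul c (hg.da hΩ hy) i
  have h2 : ∀ i j, pd j (pd i (fun y => c * g y)) x = c * pd j (pd i g) x := by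
    intro i j
    rw [pd_congr hΩ (h1 i) j x hx, pd_cmul c ((hg.pd hΩ i).da hΩ hx)]
  simp only [LL_eq, h2, h1 _ x hx, mul_add, Finset.mul_sum]
  congr 1
  · exact Finset.sum_congr rfl fun i _ => Finset.sum_congr rfl fun j _ => by ring
  · exact Finset.sum_congr rfl fun i _ => by ring

lemma LL_comp (hΩ : IsOpen Ω) {g : (Fin n → ℝ) → ℝ} (hg : Sm Ω g) {F F1 F2 : ℝ → ℝ}
    (h1 : ∀ y ∈ Ω, HasDerivAt F (F1 (g y)) (g y))
    (h2 : ∀ y ∈ Ω, HasDerivAt F1 (F2 (g y)) (g y))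
    (A : Matrix (Fin n) (Fin n) ℝ) (dv : Fin n → ℝ) {x : Fin n → ℝ} (hx : x ∈ Ω) :
    LL A dv (fun y => F (g y)) x
      = F2 (g x) * (gr g x ⬝ᵥ (A *ᵥ gr g x)) + F1 (g x) * LL A dv g x := by
  simp only [LL_eq, pd_pd_comp hΩ hg h1 h2 _ _ hx, pd_comp (h1 x hx) (hg.da hΩ hx), gr,
    dotProduct, Matrix.mulVec, mul_add, Finset.mul_sum, Finset.sum_add_distrib]
  rw [add_assoc]
  congr 1
  · exact Finset.sum_congr rfl fun i _ => Finset.sum_congr rfl fun j _ => by ring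
  congr 1
  · exact Finset.sum_congr rfl fun i _ => Finset.sum_congr rfl fun j _ => by ring
  · exact Finset.sum_congr rfl fun i _ => by ring

open scoped MatrixOrder ComplexOrder in
lemma inv_fact {U : Matrix (Fin n) (Fin n) ℝ} (hU : U.PosDef) :
    ∃ E : Matrix (Fin n) (Fin n) ℝ, U⁻¹ = E * Eᵀ := by
  obtain ⟨B, hB⟩ := CStarAlgebra.nonneg_iff_eq_star_mul_self.mp (hU.inv.posSemidef).nonneg
  refine ⟨Bᵀ, ?_⟩
  rw [hB, Matrix.transpose_transpose, Matrix.star_eq_conjTranspose,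
    Matrix.conjTranspose_eq_transpose_of_trivial]

lemma trace_nonpos (E H : Matrix (Fin n) (Fin n) ℝ)
    (h : ∀ v : Fin n → ℝ, ∑ i, ∑ j, v i * v j * H i j ≤ 0) :
    (E * Eᵀ * H).trace ≤ 0 := by
  have : (E * Eᵀ * H).trace = ∑ a, ∑ i, ∑ j, E i a * E j a * H i j := by
    simp only [Matrix.trace, Matrix.diag, Matrix.mul_apply, Matrix.transpose_apply, Finset.sum_mul]
    have e : ∀ G : Fin n → Fin n → Fin n → ℝ,
        ∑ i, ∑ j, ∑ a, G i j a = ∑ a, ∑ j, ∑ i, G i j a := by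
      intro G
      rw [Finset.sum_comm]
      rw [Finset.sum_congr rfl fun j _ => Finset.sum_comm, Finset.sum_comm]
    rw [e]
    exact Finset.sum_congr rfl fun a _ => Finset.sum_congr rfl fun i _ =>
      Finset.sum_congr rfl fun j _ => by ring
  rw [this]
  exact Finset.sum_nonpos fun a _ => h fun i => E i a

lemma LL_nonpos (hΩ : IsOpen Ω) {g : (Fin n → ℝ) → ℝ} (hg : Sm Ω g) {x : Fin n → ℝ}
    (hx : x ∈ Ω) (hmax : IsLocalMax g x) {A : Matrix (Fin n) (Fin n) ℝ} {E} (hA : A = E * Eᵀ)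
    (dv : Fin n → ℝ) : LL A dv g x ≤ 0 := by
  obtain ⟨h1, h2⟩ := second_order hΩ hg hx hmax
  have : DD dv g x = 0 := Finset.sum_eq_zero fun l _ => by rw [h1 l, mul_zero]
  unfold LL
  rw [this, hA, add_zero]
  exact trace_nonpos E _ h2

lemma gr_DD (hΩ : IsOpen Ω) {g : (Fin n → ℝ) → ℝ} (hg : Sm Ω g) (dv : Fin n → ℝ)
    {x : Fin n → ℝ} (hx : x ∈ Ω) : gr (DD dv g) x = hess g x *ᵥ dv := by
  funext i
  unfold gr
  rw [pd_DD hΩ hg dv i x hx]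
  unfold DD
  simp only [Matrix.mulVec, dotProduct]
  exact Finset.sum_congr rfl fun l _ => by
    rw [pd_comm hΩ hg l i hx]; exact mul_comm _ _

lemma gr_f (hΩ : IsOpen Ω) {g : (Fin n → ℝ) → ℝ} (hg : Sm Ω g)
    {x : Fin n → ℝ} (hx : x ∈ Ω) : gr (legendreF g) x = hess g x *ᵥ x := by
  funext i
  unfold gr
  rw [pd_f hΩ hg i x hx]
  simp only [Matrix.mulVec, dotProduct]
  exact Finset.sum_congr rfl fun l _ => mul_comm _ _

lemma DD_dot (dv : Fin n → ℝ) (g : (Fin n → ℝ) → ℝ) (x : Fin n → ℝ) :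
    DD dv g x = dv ⬝ᵥ gr g x := rfl

/-- the logarithm of the test function -/
def phi (m C k1 k2 d : ℝ) (dv : Fin n → ℝ) (u : (Fin n → ℝ) → ℝ) : (Fin n → ℝ) → ℝ := fun y =>
  -m / (C - u y) + ((-k1) * DD dv u y
    + (Real.log (DD dv (DD dv u) y) + (-k2) * Real.log (d + legendreF u y)))

lemma max_point (hn : 5 ≤ n) (hΩ : IsOpen Ω) {u : (Fin n → ℝ) → ℝ} (hu : Sm Ω u)
    (hconv : ∀ x ∈ Ω, (hess u x).PosDef) {dv : Fin n → ℝ} {d0 : ℝ}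
    (hpde : ∀ ξ ∈ Ω, (hess u ξ).det = Real.exp (-(DD dv u ξ) - d0))
    (hq : ∀ ξ ∈ Ω, 0 < DD dv (DD dv u) ξ) {C d : ℝ}
    (hs : ∀ ξ ∈ Ω, 0 < d + legendreF u ξ)
    (hC0 : 0 < C) (huC : ∀ ξ ∈ Ω, u ξ < C) {x : Fin n → ℝ} (hx : x ∈ Ω)
    (hux : 0 ≤ u x) (hst : C - u x ≤ 2 * (d + legendreF u x))
    (hgx : |u x + legendreF u x| ≤ d + legendreF u x)
    (hmax : IsLocalMax (phi (32 * ((n : ℝ) + 2) * C) C (alph n / (n + 2))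
      (2 * (n : ℝ) * alph n / ((n : ℝ) + 2)) d dv u) x) :
    DD dv (DD dv u) x ≤ 10 * ((n : ℝ) + 2) ^ 2 * (32 * ((n : ℝ) + 2) * C / (C - u x) ^ 2) := by
  set m := 32 * ((n : ℝ) + 2) * C with hm
  have hmpos : 0 < m := by positivity
  set k1 := alph n / ((n : ℝ) + 2) with hk1
  set k2 := 2 * (n : ℝ) * alph n / ((n : ℝ) + 2) with hk2
  obtain ⟨E, hE⟩ := inv_fact (hconv x hx)
  have hud := hu.DD hΩ dv
  have hqS := hud.DD hΩ dv
  have hf := sm_f hΩ hu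
  have hsS : Sm Ω (fun y => d + legendreF u y) := contDiffOn_const.add hf
  -- one-variable derivatives
  have a1 : ∀ y ∈ Ω, HasDerivAt (fun t => -m / (C - t)) (-m / (C - u y) ^ 2) (u y) := by
    intro y hy
    have h0 : C - u y ≠ 0 := (sub_pos.2 (huC y hy)).ne'
    have := ((hasDerivAt_const (u y) (-m)).div ((hasDerivAt_id (u y)).const_sub C) h0)
    refine this.congr_deriv ?_
    simp
  have a2 : ∀ y ∈ Ω, HasDerivAt (fun t => -m / (C - t) ^ 2) (-2 * m / (C - u y) ^ 3) (u y) := by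
    intro y hy
    have h0 : C - u y ≠ 0 := (sub_pos.2 (huC y hy)).ne'
    have := ((hasDerivAt_const (u y) (-m)).div (((hasDerivAt_id (u y)).const_sub C).pow 2)
      (pow_ne_zero 2 h0))
    refine this.congr_deriv ?_
    simp
    field_simp
  have l1 : ∀ t : ℝ, 0 < t → HasDerivAt Real.log (1 / t) t := fun t ht => by
    simpa using Real.hasDerivAt_log ht.ne'
  have l2 : ∀ t : ℝ, 0 < t → HasDerivAt (fun t : ℝ => 1 / t) (-1 / t ^ 2) t := fun t ht => by
    have := hasDerivAt_inv ht.ne'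
    simp only [one_div]
    refine this.congr_deriv ?_
    simp [neg_div]
  have s1 : Sm Ω (fun y => -m / (C - u y)) :=
    contDiffOn_const.div (contDiffOn_const.sub hu) fun y hy => (sub_pos.2 (huC y hy)).ne'
  have s2 : Sm Ω (fun y => (-k1) * DD dv u y) := contDiffOn_const.mul hud
  have s3' : Sm Ω (fun y => Real.log (DD dv (DD dv u) y)) := hqS.log fun y hy => (hq y hy).ne'
  have s4' : Sm Ω (fun y => Real.log (d + legendreF u y)) := hsS.log fun y hy => (hs y hy).ne'
  have s4 : Sm Ω (fun y => (-k2) * Real.log (d + legendreF u y)) := contDiffOn_const.mul s4'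
  have s34 : Sm Ω (fun y => Real.log (DD dv (DD dv u) y) + (-k2) * Real.log (d + legendreF u y)) :=
    s3'.add s4
  have s234 : Sm Ω (fun y => (-k1) * DD dv u y
    + (Real.log (DD dv (DD dv u) y) + (-k2) * Real.log (d + legendreF u y))) := s2.add s34
  have sphi : Sm Ω (phi m C k1 k2 d dv u) := s1.add s234
  have hgr := (second_order hΩ sphi hx hmax).1
  have hL := LL_nonpos hΩ sphi hx hmax hE dv
  have hgs : gr (fun y => d + legendreF u y) x = hess u x *ᵥ x := by
    rw [← gr_f hΩ hu hx]; funext i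
    unfold gr
    rw [pd_add' (differentiableAt_const _) (hf.da hΩ hx), pd_const, zero_add]
  have hgud := gr_DD hΩ hu dv hx
  have hgq := gr_DD hΩ hud dv hx
  have Ls : LL (hess u x)⁻¹ dv (fun y => d + legendreF u y) x = n := by
    have h := LL_add hΩ (f := fun _ => d) contDiffOn_const hf (hess u x)⁻¹ dv hx
    have h0 : LL (hess u x)⁻¹ dv (fun _ => d) x = 0 := by
      rw [LL_eq]
      have : ∀ i : Fin n, pd i (fun _ : Fin n → ℝ => d) = fun _ => 0 := fun i =>
        funext fun y => pd_const d y i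
      simp [this, pd_const]
    rw [h, h0, zero_add]
    exact lap_f hΩ hu hconv hpde hx
  have Lq : LL (hess u x)⁻¹ dv (DD dv (DD dv u)) x
     = ((hess u x)⁻¹ * hess (DD dv u) x * ((hess u x)⁻¹ * hess (DD dv u) x)).trace := by
    unfold LL
    rw [lap_q hΩ hu hconv hpde hx]; ring
  have Lud : LL (hess u x)⁻¹ dv (DD dv u) x = 0 := by
    unfold LL
    rw [lap_ud hΩ hu hconv hpde hx]; ring
  have Lu : LL (hess u x)⁻¹ dv u x = n + gr u x ⬝ᵥ dv := by
    unfold LL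
    rw [inv_mul_hess hΩ hu hconv hx, DD_dot, dotProduct_comm]; simp
  have hLe : LL (hess u x)⁻¹ dv (phi m C k1 k2 d dv u) x = _ :=
    LL_add hΩ s1 s234 (hess u x)⁻¹ dv hx
  rw [LL_add hΩ s2 s34 (hess u x)⁻¹ dv hx, LL_add hΩ s3' s4 (hess u x)⁻¹ dv hx,
    LL_cmul hΩ hud _ _ _ hx, LL_cmul hΩ s4' _ _ _ hx,
    LL_comp hΩ hu (F1 := fun t => -m / (C - t) ^ 2) (F2 := fun t => -2 * m / (C - t) ^ 3) a1 a2 _ _ hx,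
    LL_comp hΩ hqS (F := Real.log) (F1 := fun t => 1 / t) (F2 := fun t => -1 / t ^ 2)
      (fun y hy => l1 _ (hq y hy)) (fun y hy => l2 _ (hq y hy)) _ _ hx,
    LL_comp hΩ hsS (F := Real.log) (F1 := fun t => 1 / t) (F2 := fun t => -1 / t ^ 2)
      (fun y hy => l1 _ (hs y hy)) (fun y hy => l2 _ (hs y hy)) _ _ hx,
    Ls, Lq, Lud, Lu, hgs, hgq] at hLe
  rw [hLe] at hL
  have htpos : 0 < C - u x := sub_pos.2 (huC x hx)
  have hspos := hs x hx
  have hqpos := hq x hx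
  refine pointwise hn (hess u x) (hess u x)⁻¹ E (hess (DD dv u) x) hE
    (inv_mul_hess hΩ hu hconv hx) (hess_symm hΩ hud hx) (gr u x) dv x
    (DD dv (DD dv u) x) _ (m / (C - u x) ^ 2) (C - u x) (d + legendreF u x)
    (by rw [← hgud]; rfl) hqpos (lap_ud hΩ hu hconv hpde hx) rfl (by positivity) htpos hspos
    ?_ hst ?_ ?_ ?_
  · have : m / (C - u x) ^ 2 * (C - u x) = 32 * ((n : ℝ) + 2) * C / (C - u x) := by
      rw [hm]; field_simp
    rw [this, le_div_iff₀ htpos]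
    apply mul_le_mul_of_nonneg_left (by linarith) (by positivity)
  · have : gr u x ⬝ᵥ x = u x + legendreF u x := by
      rw [dotProduct_comm]; unfold legendreF; simp only [dotProduct, gr]; ring
    rw [this]; exact hgx
  · intro i
    have h := hgr i
    have hphi : pd i (phi m C k1 k2 d dv u) x = _ :=
      pd_add' (s1.da hΩ hx) (s234.da hΩ hx) i
    rw [pd_add' (s2.da hΩ hx) (s34.da hΩ hx) i, pd_add' (s3'.da hΩ hx) (s4.da hΩ hx) i,
      pd_cmul _ (hud.da hΩ hx), pd_cmul _ (s4'.da hΩ hx), pd_comp (a1 x hx) (hu.da hΩ hx),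
      pd_comp (l1 _ hqpos) (hqS.da hΩ hx), pd_comp (l1 _ hspos) (hsS.da hΩ hx), h] at hphi
    have e1 := congrFun hgud i
    have e2 := congrFun hgq i
    have e3 := congrFun hgs i
    simp only [gr] at e1 e2 e3
    rw [e1, e2, e3] at hphi
    simp only [gr]
    rw [hphi]
    ring
  · refine le_of_eq_of_le ?_ hL
    generalize C - u x = t
    generalize d + legendreF u x = s
    ring

end maxpt

section phi
variable {n : ℕ} {Ω : Set (Fin n → ℝ)}

lemma rho_eq {u : (Fin n → ℝ) → ℝ} {dv : Fin n → ℝ} {d0 : ℝ}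
    (hpde : ∀ ξ ∈ Ω, (hess u ξ).det = Real.exp (-(DD dv u ξ) - d0)) :
    ∀ x ∈ Ω, rhoU u x = Real.exp ((-(DD dv u x) - d0) * (1 / ((n : ℝ) + 2))) := by
  intro x hx
  unfold rhoU
  rw [hpde x hx, ← Real.exp_mul]

lemma Phi_eq (hΩ : IsOpen Ω) {u : (Fin n → ℝ) → ℝ} (hu : Sm Ω u)
    (hconv : ∀ x ∈ Ω, (hess u x).PosDef) {dv : Fin n → ℝ} {d0 : ℝ}
    (hpde : ∀ ξ ∈ Ω, (hess u ξ).det = Real.exp (-(DD dv u ξ) - d0)) :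
    ∀ x ∈ Ω, PhiU u x = DD dv (DD dv u) x / ((n : ℝ) + 2) ^ 2 := by
  intro x hx
  have hud := hu.DD hΩ dv
  have hr := rho_eq hpde
  have hpos : 0 < rhoU u x := by rw [hr x hx]; exact Real.exp_pos _
  have hg : ∀ i, pd i (rhoU u) x = rhoU u x * (-(1 / ((n : ℝ) + 2))) * gr (DD dv u) x i := by
    intro i
    rw [pd_congr hΩ hr i x hx, hr x hx]
    have : HasDerivAt (fun t : ℝ => Real.exp ((-t - d0) * (1 / ((n : ℝ) + 2))))
        (Real.exp ((-(DD dv u x) - d0) * (1 / ((n : ℝ) + 2))) * (-(1 / ((n : ℝ) + 2)))) (DD dv u x) := by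
      have h := ((((hasDerivAt_id (DD dv u x)).neg).sub_const d0).mul_const (1 / ((n : ℝ) + 2))).exp
      refine h.congr_deriv ?_
      simp
    rw [pd_comp this (hud.da hΩ hx)]; rfl
  have hsum : ∑ i, ∑ j, (hess u x)⁻¹ i j * pd i (rhoU u) x * pd j (rhoU u) x
      = (rhoU u x) ^ 2 * (1 / ((n : ℝ) + 2)) ^ 2
        * (gr (DD dv u) x ⬝ᵥ ((hess u x)⁻¹ *ᵥ gr (DD dv u) x)) := by
    simp only [hg, dotProduct, Matrix.mulVec, Finset.mul_sum]
    exact Finset.sum_congr rfl fun i _ => Finset.sum_congr rfl fun j _ => by ring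
  have hq : gr (DD dv u) x ⬝ᵥ ((hess u x)⁻¹ *ᵥ gr (DD dv u) x) = DD dv (DD dv u) x := by
    conv_lhs => rw [gr_DD hΩ hu dv hx, Matrix.mulVec_mulVec, inv_mul_hess hΩ hu hconv hx,
      Matrix.one_mulVec]
    rw [DD_dot, gr_DD hΩ hu dv hx, dotProduct_comm]
  unfold PhiU
  rw [hsum, hq]
  field_simp

lemma q_pos (hΩ : IsOpen Ω) {u : (Fin n → ℝ) → ℝ} (hu : Sm Ω u)
    (hconv : ∀ x ∈ Ω, (hess u x).PosDef) {dv : Fin n → ℝ} (hdv : dv ≠ 0) :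
    ∀ x ∈ Ω, 0 < DD dv (DD dv u) x := by
  intro x hx
  rw [DD_dot, gr_DD hΩ hu dv hx]
  have := (hconv x hx).dotProduct_mulVec_pos hdv
  simpa using this

/-- continuous extension of the test function -/
lemma glue_eq {m t : ℝ} (hm : 0 < m) (ht : 0 < t) :
    expNegInvGlue (t / m) = Real.exp (-m / t) := by
  have : 0 < t / m := div_pos ht hm
  unfold expNegInvGlue
  rw [if_neg (not_le.2 this), inv_div, neg_div]

lemma exp_bound {m t : ℝ} (hm : 0 < m) (ht : 0 < t) :
    Real.exp (-m / t) * (m / t ^ 2) ≤ 2 / m := by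
  have h := Real.quadratic_le_exp_of_nonneg (div_pos hm ht).le
  have h2 : (m / t) ^ 2 / 2 ≤ Real.exp (m / t) := by
    have := div_pos hm ht
    linarith
  rw [neg_div, Real.exp_neg, inv_mul_le_iff₀ (Real.exp_pos _)]
  calc m / t ^ 2 = (m / t) ^ 2 / 2 * (2 / m) := by field_simp
    _ ≤ _ := mul_le_mul_of_nonneg_right h2 (by positivity)

lemma alph_pos (hn : 5 ≤ n) : 0 < alph n := by
  have : (5 : ℝ) ≤ n := by exact_mod_cast hn
  unfold alph
  have : 0 < ((n : ℝ) + 2) * ((n : ℝ) - 3) := mul_pos (by linarith) (by linarith)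
  linarith

end phi
/-- Under the hypotheses of Lemma 6.1, the supremum of
`exp(−m/(C−u)) ρ^α Φ/(d+f)^{2nα/(n+2)}` over `S_u(p,C)` is at most `10` times
the supremum of `exp(−m/(C−u)+H)(h+2α) ρ^α/(d+f)^{2nα/(n+2)}` over `S_u(p,C)`. -/
theorem sup_A_le_ten_sup_B (n : ℕ) (hn : 5 ≤ n) (b₁ : ℝ) (hb₁ : 0 ≤ b₁)
    (C : ℝ) (hC0 : 0 < C) (hC1 : C ≤ 1)
    (Ω : Set (Fin n → ℝ)) (hΩo : IsOpen Ω) (hΩc : Convex ℝ Ω)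
    (u : (Fin n → ℝ) → ℝ) (hu : ContDiffOn ℝ (⊤ : ℕ∞) u Ω)
    (hconv : ∀ x ∈ Ω, (hess u x).PosDef)
    (dv : Fin n → ℝ) (d0 : ℝ)
    (hpde : ∀ ξ ∈ Ω,
      (hess u ξ).det = Real.exp (-(∑ i : Fin n, dv i * pd i u ξ) - d0))
    (hnonneg : ∀ ξ ∈ Ω, 0 ≤ u ξ)
    (p : Fin n → ℝ) (hp : p ∈ Ω) (hup : u p = 0)
    (hcpt : IsCompact {ξ ∈ Ω | u ξ ≤ C})
    (d : ℝ) (hd : 1 < d)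
    (hbnd : ∀ ξ ∈ {ξ ∈ Ω | u ξ ≤ C},
      (∑ i : Fin n, (pd i u ξ) ^ 2) / (d + legendreF u ξ) ^ 2 ≤ b₁ ∧
        |u ξ + legendreF u ξ| ≤ d + legendreF u ξ) :
    sSup ((fun ξ =>
        Real.exp (-(32 * ((n : ℝ) + 2) * C) / (C - u ξ)) *
          (rhoU u ξ) ^ (alph n) * PhiU u ξ /
          (d + legendreF u ξ) ^ (2 * (n : ℝ) * alph n / ((n : ℝ) + 2))) ''
        {ξ ∈ Ω | u ξ < C}) ≤
      10 * sSup ((fun ξ =>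
        Real.exp (-(32 * ((n : ℝ) + 2) * C) / (C - u ξ)
            + (1 / (30 * (1 + b₁))) *
                (∑ i : Fin n, (pd i u ξ) ^ 2) / (d + legendreF u ξ) ^ 2) *
          (32 * ((n : ℝ) + 2) * C / (C - u ξ) ^ 2 + 2 * alph n) *
          (rhoU u ξ) ^ (alph n) /
          (d + legendreF u ξ) ^ (2 * (n : ℝ) * alph n / ((n : ℝ) + 2))) ''
        {ξ ∈ Ω | u ξ < C}) := by
  set m := 32 * ((n : ℝ) + 2) * C with hm
  have hmpos : 0 < m := by positivity
  set k2 := 2 * (n : ℝ) * alph n / ((n : ℝ) + 2) with hk2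
  have hα := alph_pos hn
  have hpde' : ∀ ξ ∈ Ω, (hess u ξ).det = Real.exp (-(DD dv u ξ) - d0) := hpde
  have hrho := rho_eq hpde'
  have hPhi := Phi_eq hΩo hu hconv hpde'
  have hrpos : ∀ x ∈ Ω, 0 < rhoU u x := fun x hx => by rw [hrho x hx]; exact Real.exp_pos _
  have hs2 : ∀ ξ ∈ Ω, u ξ ≤ C → C - u ξ < 2 * (d + legendreF u ξ) := by
    intro ξ hξ hC
    have := (abs_le.1 (hbnd ξ ⟨hξ, hC⟩).2).1
    linarith
  have hs : ∀ ξ ∈ Ω, u ξ ≤ C → 0 < d + legendreF u ξ := by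
    intro ξ hξ hC
    have := hs2 ξ hξ hC
    linarith
  have hud : Sm Ω (DD dv u) := Sm.DD hΩo hu dv
  have hqS : Sm Ω (DD dv (DD dv u)) := Sm.DD hΩo hud dv
  have hfS : Sm Ω (legendreF u) := sm_f hΩo hu
  have hpS : p ∈ {ξ ∈ Ω | u ξ < C} := ⟨hp, by rw [hup]; exact hC0⟩
  have hKΩ : {ξ ∈ Ω | u ξ ≤ C} ⊆ Ω := fun x hx => hx.1
  -- the weight `ρ^α / s^κ`
  have hrc : ContinuousOn (rhoU u) {ξ ∈ Ω | u ξ ≤ C} := by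
    have : ContinuousOn (fun x => Real.exp ((-(DD dv u x) - d0) * (1 / ((n : ℝ) + 2)))) Ω :=
      (((hud.continuousOn.neg).sub continuousOn_const).mul continuousOn_const).rexp
    exact (this.congr hrho).mono hKΩ
  have hwc : ContinuousOn (fun ξ => rhoU u ξ ^ alph n / (d + legendreF u ξ) ^ k2)
      {ξ ∈ Ω | u ξ ≤ C} := by
    apply ContinuousOn.div
    · exact hrc.rpow_const fun x hx => Or.inl (hrpos x hx.1).ne'
    · exact (continuousOn_const.add (hfS.continuousOn.mono hKΩ)).rpow_const
        fun x hx => Or.inl (hs x hx.1 hx.2).ne'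
    · exact fun x hx => (Real.rpow_pos_of_pos (hs x hx.1 hx.2) _).ne'
  have hwpos : ∀ ξ ∈ Ω, u ξ ≤ C → 0 < rhoU u ξ ^ alph n / (d + legendreF u ξ) ^ k2 :=
    fun x hx hC => div_pos (Real.rpow_pos_of_pos (hrpos x hx) _)
      (Real.rpow_pos_of_pos (hs x hx hC) _)
  -- boundedness of the right-hand side family
  obtain ⟨W, hW⟩ := hcpt.bddAbove_image hwc
  have hW' : ∀ ξ ∈ Ω, u ξ ≤ C → rhoU u ξ ^ alph n / (d + legendreF u ξ) ^ k2 ≤ W :=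
    fun x hx hC => hW ⟨x, ⟨hx, hC⟩, rfl⟩
  set B : (Fin n → ℝ) → ℝ := fun ξ =>
        Real.exp (-m / (C - u ξ)
            + (1 / (30 * (1 + b₁))) *
                (∑ i : Fin n, (pd i u ξ) ^ 2) / (d + legendreF u ξ) ^ 2) *
          (m / (C - u ξ) ^ 2 + 2 * alph n) *
          (rhoU u ξ) ^ (alph n) /
          (d + legendreF u ξ) ^ k2 with hB
  have hBeq : ∀ ξ, B ξ = Real.exp ((1 / (30 * (1 + b₁))) *
                (∑ i : Fin n, (pd i u ξ) ^ 2) / (d + legendreF u ξ) ^ 2) *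
        (Real.exp (-m / (C - u ξ)) * (m / (C - u ξ) ^ 2 + 2 * alph n)) *
        (rhoU u ξ ^ alph n / (d + legendreF u ξ) ^ k2) := by
    intro ξ
    simp only [hB]
    rw [Real.exp_add]; ring
  have hHnn : ∀ ξ, 0 ≤ (1 / (30 * (1 + b₁))) *
                (∑ i : Fin n, (pd i u ξ) ^ 2) / (d + legendreF u ξ) ^ 2 := by
    intro ξ; positivity
  have hBbdd : BddAbove (B '' {ξ ∈ Ω | u ξ < C}) := by
    refine ⟨Real.exp 1 * (2 / m + 2 * alph n) * W, ?_⟩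
    rintro _ ⟨ξ, ⟨hξ, hξC⟩, rfl⟩
    have ht : 0 < C - u ξ := sub_pos.2 hξC
    rw [hBeq]
    have h1 : (1 / (30 * (1 + b₁))) *
                (∑ i : Fin n, (pd i u ξ) ^ 2) / (d + legendreF u ξ) ^ 2 ≤ 1 := by
      rw [mul_div_assoc]
      have h := (hbnd ξ ⟨hξ, hξC.le⟩).1
      calc _ ≤ 1 / (30 * (1 + b₁)) * b₁ := mul_le_mul_of_nonneg_left h (by positivity)
        _ ≤ 1 := by
          rw [one_div, inv_mul_le_iff₀ (by positivity)]; linarith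
    have h2 : Real.exp (-m / (C - u ξ)) * (m / (C - u ξ) ^ 2 + 2 * alph n)
        ≤ 2 / m + 2 * alph n := by
      rw [mul_add]
      have e1 := exp_bound hmpos ht
      have e2 : Real.exp (-m / (C - u ξ)) ≤ 1 := by
        rw [Real.exp_le_one_iff, neg_div]
        have := div_pos hmpos ht
        linarith
      have e3 : Real.exp (-m / (C - u ξ)) * (2 * alph n) ≤ 1 * (2 * alph n) :=
        mul_le_mul_of_nonneg_right e2 (by positivity)
      linarith
    have h3 := hW' ξ hξ hξC.le
    have h4 := hwpos ξ hξ hξC.le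
    have h5 := Real.exp_le_exp.2 h1
    have h6 : 0 < 2 / m + 2 * alph n := by positivity
    exact mul_le_mul (mul_le_mul h5 h2 (by positivity) (Real.exp_pos _).le) h3 h4.le (by positivity)
  have hBnn : ∀ ξ ∈ {ξ ∈ Ω | u ξ < C}, 0 ≤ B ξ := by
    rintro ξ ⟨hξ, hξC⟩
    have ht : 0 < C - u ξ := sub_pos.2 hξC
    rw [hBeq]
    have h4 := hwpos ξ hξ hξC.le
    positivity
  have hSB : 0 ≤ sSup (B '' {ξ ∈ Ω | u ξ < C}) := by
    apply Real.sSup_nonneg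
    rintro _ ⟨ξ, hξ, rfl⟩
    exact hBnn ξ hξ
  apply csSup_le (Set.Nonempty.image _ ⟨p, hpS⟩)
  rintro _ ⟨ξ, ⟨hξ, hξC⟩, rfl⟩
  simp only
  rw [hPhi ξ hξ]
  by_cases hdv : dv = 0
  · have : DD dv (DD dv u) ξ = 0 := by
      rw [DD_dot, hdv, zero_dotProduct]
    rw [this]
    simp only [zero_div, mul_zero]
    linarith
  have hq := q_pos hΩo hu hconv hdv
  -- continuous extension
  set G : (Fin n → ℝ) → ℝ := fun ξ => expNegInvGlue ((C - u ξ) / m) *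
    (rhoU u ξ ^ alph n / (d + legendreF u ξ) ^ k2) * DD dv (DD dv u) ξ with hG
  have hGc : ContinuousOn G {ξ ∈ Ω | u ξ ≤ C} := by
    have h1 : ContinuousOn (fun ξ => expNegInvGlue ((C - u ξ) / m)) {ξ ∈ Ω | u ξ ≤ C} := by
      have h0 : ContinuousOn (fun ξ => (C - u ξ) / m) {ξ ∈ Ω | u ξ ≤ C} :=
        (continuousOn_const.sub (hu.continuousOn.mono hKΩ)).div_const _
      exact (expNegInvGlue.contDiff (n := 0)).continuous.comp_continuousOn h0
    exact (h1.mul hwc).mul (hqS.continuousOn.mono hKΩ)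
  obtain ⟨x, hxK, hxmax⟩ := hcpt.exists_isMaxOn ⟨p, hp, by rw [hup]; exact hC0.le⟩ hGc
  have hGval : ∀ y ∈ Ω, u y < C → G y = Real.exp (-m / (C - u y)) *
      (rhoU u y ^ alph n / (d + legendreF u y) ^ k2) * DD dv (DD dv u) y := by
    intro y hy hyC
    simp only [hG]
    rw [glue_eq hmpos (sub_pos.2 hyC)]
  have hGpos : ∀ y ∈ Ω, u y < C → 0 < G y := by
    intro y hy hyC
    rw [hGval y hy hyC]
    exact mul_pos (mul_pos (Real.exp_pos _) (hwpos y hy hyC.le)) (hq y hy)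
  have hxC : u x < C := by
    rcases lt_or_eq_of_le hxK.2 with h | h
    · exact h
    · exfalso
      have h1 : G p ≤ G x := hxmax ⟨hp, by rw [hup]; exact hC0.le⟩
      have h2 := hGpos p hpS.1 hpS.2
      have h3 : G x = 0 := by
        simp only [hG, h]
        simp
      linarith
  have hxΩ := hxK.1
  have hOpen : IsOpen {ξ ∈ Ω | u ξ < C} :=
    hu.continuousOn.isOpen_inter_preimage hΩo isOpen_Iio
  have hsub : {ξ ∈ Ω | u ξ < C} ⊆ Ω := fun y hy => hy.1
  have hlog : ∀ y ∈ {ξ ∈ Ω | u ξ < C}, Real.log (G y)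
      = phi m C (alph n / (n + 2)) k2 d dv u y - alph n / (n + 2) * d0 := by
    rintro y ⟨hy, hyC⟩
    have hsy := hs y hy hyC.le
    rw [hGval y hy hyC, Real.log_mul (mul_pos (Real.exp_pos _) (hwpos y hy hyC.le)).ne' (hq y hy).ne',
      Real.log_mul (Real.exp_pos _).ne' (hwpos y hy hyC.le).ne', Real.log_exp,
      Real.log_div (Real.rpow_pos_of_pos (hrpos y hy) _).ne' (Real.rpow_pos_of_pos hsy _).ne',
      Real.log_rpow (hrpos y hy), Real.log_rpow hsy, hrho y hy, Real.log_exp]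
    unfold phi
    ring
  have hlm : IsLocalMax (phi m C (alph n / (n + 2)) k2 d dv u) x := by
    filter_upwards [hOpen.mem_nhds ⟨hxΩ, hxC⟩] with y hy
    have h1 : G y ≤ G x := hxmax ⟨hy.1, hy.2.le⟩
    have h2 := Real.log_le_log (hGpos y hy.1 hy.2) h1
    rw [hlog y hy, hlog x ⟨hxΩ, hxC⟩] at h2
    linarith
  have hmp := max_point hn hOpen (hu.mono hsub) (fun y hy => hconv y hy.1)
    (fun y hy => hpde' y hy.1) (fun y hy => hq y hy.1) (fun y hy => hs y hy.1 hy.2.le) hC0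
    (fun y hy => hy.2) (x := x) ⟨hxΩ, hxC⟩ (hnonneg x hxΩ) (hs2 x hxΩ hxC.le).le
    (hbnd x hxK).2 hlm
  rw [← hm] at hmp
  have hmaxξ : G ξ ≤ G x := hxmax ⟨hξ, hξC.le⟩
  have hBx : B x ≤ sSup (B '' {ξ ∈ Ω | u ξ < C}) := le_csSup hBbdd ⟨x, ⟨hxΩ, hxC⟩, rfl⟩
  have hN : 0 < ((n : ℝ) + 2) ^ 2 := by positivity
  have hGx : G x / ((n : ℝ) + 2) ^ 2 ≤ 10 * B x := by
    rw [div_le_iff₀ hN, hGval x hxΩ hxC, hBeq]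
    have ht : 0 < C - u x := sub_pos.2 hxC
    have hw := hwpos x hxΩ hxC.le
    have he : 1 ≤ Real.exp ((1 / (30 * (1 + b₁))) *
                (∑ i : Fin n, (pd i u x) ^ 2) / (d + legendreF u x) ^ 2) :=
      Real.one_le_exp (hHnn x)
    generalize Real.exp ((1 / (30 * (1 + b₁))) *
                (∑ i : Fin n, (pd i u x) ^ 2) / (d + legendreF u x) ^ 2) = e at he ⊢
    generalize rhoU u x ^ alph n / (d + legendreF u x) ^ k2 = w at hw ⊢
    have hE := Real.exp_pos (-m / (C - u x))
    generalize Real.exp (-m / (C - u x)) = E at hE ⊢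
    have hh : 0 < m / (C - u x) ^ 2 := by positivity
    generalize m / (C - u x) ^ 2 = h at hh hmp ⊢
    calc E * w * DD dv (DD dv u) x ≤ E * w * (10 * ((n : ℝ) + 2) ^ 2 * h) :=
          mul_le_mul_of_nonneg_left hmp (by positivity)
      _ = 1 * (10 * ((n : ℝ) + 2) ^ 2 * E * w * h) := by ring
      _ ≤ e * (10 * ((n : ℝ) + 2) ^ 2 * E * w * (h + 2 * alph n)) := by
          apply mul_le_mul he _ (by positivity) (by linarith)
          exact mul_le_mul_of_nonneg_left (by linarith) (by positivity)
      _ = _ := by ring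
  calc _ = G ξ / ((n : ℝ) + 2) ^ 2 := by
        rw [hGval ξ hξ hξC]; ring
    _ ≤ G x / ((n : ℝ) + 2) ^ 2 := div_le_div_of_nonneg_right hmaxξ hN.le
    _ ≤ 10 * B x := hGx
    _ ≤ _ := by linarith
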